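/- arXiv:2109.02819 — 2 statements merged into one kernel-verified Lean document; each statement's English description precedes it below -/
import Mathlib

section
/- Let A and B be positive definite complex matrices of size nk × nk, each regarded as an n × n block matrix with k × k blocks. Then det(A ∘ B) ≥ det(AB) · ∏_{μ=2}^{n} ( (det A_{μμ} · det A_{μ−1}) / det A_{μ} + (det B_{μμ} · det B_{μ−1}) / det B_{μ} − 1 ), where all determinants of positive definite matrices are positive reals and the stated inequality is an inequality of real numbers. -/
open Matrix ComplexOrder

/-- The `μk × μk` leading principal block submatrix `A_μ` (for `μ ≤ n`) of an
`n × n` block matrix with `k × k` blocks. -/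
def leadBlock {n k : ℕ} (A : Matrix (Fin n × Fin k) (Fin n × Fin k) ℂ)
    (μ : ℕ) (h : μ ≤ n) : Matrix (Fin μ × Fin k) (Fin μ × Fin k) ℂ :=
  A.submatrix (fun p => (Fin.castLE h p.1, p.2)) (fun p => (Fin.castLE h p.1, p.2))

/-- The `μ`-th (1-based) diagonal `k × k` block `A_{μμ}` of an
`n × n` block matrix with `k × k` blocks. -/
def diagBlock {n k : ℕ} (A : Matrix (Fin n × Fin k) (Fin n × Fin k) ℂ)
    (μ : ℕ) (h : μ - 1 < n) : Matrix (Fin k) (Fin k) ℂ :=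
  Matrix.of fun a b => A (⟨μ - 1, h⟩, a) (⟨μ - 1, h⟩, b)

section BorderedMatrix

variable {m : Type*}

/-- The matrix with corner entry `c` and zeros elsewhere. -/
def cornerMatrix (m : Type*) (c : ℂ) : Matrix (m ⊕ Unit) (m ⊕ Unit) ℂ :=
  fromBlocks 0 0 0 (Matrix.of fun _ _ => c)

lemma sub_cornerMatrix (M : Matrix (m ⊕ Unit) (m ⊕ Unit) ℂ) (c : ℂ) :
    M - cornerMatrix m c = fromBlocks M.toBlocks₁₁ M.toBlocks₁₂ M.toBlocks₂₁
      (M.toBlocks₂₂ - Matrix.of fun _ _ => c) := by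
  ext (i | i) (j | j) <;> simp [cornerMatrix, toBlocks₁₁, toBlocks₁₂, toBlocks₂₁, toBlocks₂₂]

lemma Matrix.PosDef.toBlocks₁₁ {M : Matrix (m ⊕ Unit) (m ⊕ Unit) ℂ} (hM : M.PosDef) :
    M.toBlocks₁₁.PosDef :=
  hM.submatrix Sum.inl_injective

variable [Fintype m] [DecidableEq m]

lemma det_sub_cornerMatrix (M : Matrix (m ⊕ Unit) (m ⊕ Unit) ℂ) (h : IsUnit M.toBlocks₁₁) (c : ℂ) :
    (M - cornerMatrix m c).det = M.det - c * M.toBlocks₁₁.det := by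
  obtain ⟨_⟩ := h.nonempty_invertible
  conv_rhs => rw [← fromBlocks_toBlocks M]
  rw [sub_cornerMatrix, det_fromBlocks₁₁, det_fromBlocks₁₁, toBlocks_fromBlocks₁₁,
    det_unique (n := Unit), det_unique (n := Unit)]
  simp only [Matrix.sub_apply, of_apply]
  ring

lemma Matrix.PosDef.posSemidef_sub_cornerMatrix {M : Matrix (m ⊕ Unit) (m ⊕ Unit) ℂ}
    (hM : M.PosDef) :
    (M - cornerMatrix m (M.det / M.toBlocks₁₁.det)).PosSemidef := by
  have h11 := hM.toBlocks₁₁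
  have hu := h11.isUnit
  obtain ⟨_⟩ := hu.nonempty_invertible
  have hd := det_sub_cornerMatrix M hu (M.det / M.toBlocks₁₁.det)
  rw [div_mul_cancel₀ _ h11.det_pos.ne', sub_self] at hd
  have h21 : M.toBlocks₂₁ = M.toBlocks₁₂ᴴ := by
    ext i j
    exact (hM.isHermitian.apply (Sum.inr i) (Sum.inl j)).symm
  have hM' : M - cornerMatrix m (M.det / M.toBlocks₁₁.det) =
      fromBlocks M.toBlocks₁₁ M.toBlocks₁₂ M.toBlocks₁₂ᴴ
        (M.toBlocks₂₂ - Matrix.of fun _ _ => M.det / M.toBlocks₁₁.det) := by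
    rw [sub_cornerMatrix, h21]
  rw [hM'] at hd ⊢
  rw [h11.fromBlocks₁₁]
  rw [det_fromBlocks₁₁, mul_eq_zero, or_iff_right h11.det_pos.ne', det_unique,
    invOf_eq_nonsing_inv] at hd
  convert! Matrix.PosSemidef.zero
  ext i j
  exact hd

lemma Matrix.PosDef.det_div_le_corner {M : Matrix (m ⊕ Unit) (m ⊕ Unit) ℂ} (hM : M.PosDef) :
    M.det / M.toBlocks₁₁.det ≤ M (Sum.inr ()) (Sum.inr ()) := by
  have := hM.posSemidef_sub_cornerMatrix.diag_nonneg (i := Sum.inr ())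
  simpa [cornerMatrix] using this

/-- A one-step bound for the determinant of a Hadamard product of bordered matrices. -/
lemma Matrix.PosDef.le_det_hadamard {A B : Matrix (m ⊕ Unit) (m ⊕ Unit) ℂ}
    (hA : A.PosDef) (hB : B.PosDef) :
    (A (Sum.inr ()) (Sum.inr ()) * (B.det / B.toBlocks₁₁.det) +
        A.det / A.toBlocks₁₁.det * B (Sum.inr ()) (Sum.inr ()) -
        A.det / A.toBlocks₁₁.det * (B.det / B.toBlocks₁₁.det)) *
      (A.toBlocks₁₁ ⊙ B.toBlocks₁₁).det ≤ (A ⊙ B).det := by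
  have h := (hA.posSemidef_sub_cornerMatrix.hadamard hB.posSemidef_sub_cornerMatrix).det_nonneg
  set α := A.det / A.toBlocks₁₁.det
  set β := B.det / B.toBlocks₁₁.det
  have e : (A - cornerMatrix m α) ⊙ (B - cornerMatrix m β) = A ⊙ B -
      cornerMatrix m (A (Sum.inr ()) (Sum.inr ()) * β + α * B (Sum.inr ()) (Sum.inr ()) - α * β) := by
    ext (i | i) (j | j) <;> simp [cornerMatrix]
    ring
  rw [e, det_sub_cornerMatrix _ (hA.hadamard hB).toBlocks₁₁.isUnit] at h
  exact sub_nonneg.mp h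

end BorderedMatrix

section PrincipalMinor

variable {ι : Type*}

lemma Matrix.PosDef.ofReal_re_diag {A : Matrix ι ι ℂ} (hA : A.PosDef) (i : ι) : A i i = ((A i i).re : ℂ) :=
  Complex.eq_re_of_ofReal_le (r := 0) (by simpa using hA.posSemidef.diag_nonneg (i := i))

/-- Enumerates `insert i s`, with `i` as the last index. -/
def insertEnum (s : Finset ι) (i : ι) : s ⊕ Unit → ι := Sum.elim Subtype.val fun _ => i

lemma insertEnum_injective {s : Finset ι} {i : ι} (hi : i ∉ s) : (insertEnum s i).Injective :=
  Subtype.val_injective.sumElim (Function.injective_of_subsingleton _) fun a _ h => hi (h ▸ a.2)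

variable [DecidableEq ι]

/-- The (real part of the) principal minor of `A` supported on `s`. -/
noncomputable def principalMinor (A : Matrix ι ι ℂ) (s : Finset ι) : ℝ :=
  (A.submatrix (Subtype.val : s → ι) Subtype.val).det.re

lemma det_submatrix_eq_of_range {κ : Type*} [Fintype κ] [DecidableEq κ] (A : Matrix ι ι ℂ)
    {f : κ → ι} (hf : f.Injective) {s : Finset ι} (hs : ∀ i, i ∈ s ↔ ∃ j, f j = i) :
    (A.submatrix f f).det = (A.submatrix (Subtype.val : s → ι) Subtype.val).det := by
  let e : κ ≃ s := Equiv.ofBijective (fun j => ⟨f j, (hs _).2 ⟨j, rfl⟩⟩)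
    ⟨fun a b h => hf (congrArg Subtype.val h), fun ⟨i, hi⟩ => by
      obtain ⟨j, rfl⟩ := (hs i).1 hi
      exact ⟨j, rfl⟩⟩
  rw [← det_submatrix_equiv_self e, submatrix_submatrix]
  rfl

lemma principalMinor_empty (A : Matrix ι ι ℂ) : principalMinor A ∅ = 1 := by
  simp [principalMinor]

lemma principalMinor_univ [Fintype ι] (A : Matrix ι ι ℂ) : principalMinor A Finset.univ = A.det.re := by
  rw [principalMinor, ← det_submatrix_eq_of_range A Function.injective_id (by simp), submatrix_id_id]

variable {A B : Matrix ι ι ℂ}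

lemma Matrix.PosDef.ofReal_principalMinor (hA : A.PosDef) (s : Finset ι) :
    (A.submatrix (Subtype.val : s → ι) Subtype.val).det = (principalMinor A s : ℂ) :=
  Complex.eq_re_of_ofReal_le (r := 0) (by
    simpa using (hA.submatrix Subtype.val_injective).det_pos.le)

lemma Matrix.PosDef.principalMinor_pos (hA : A.PosDef) (s : Finset ι) :
    0 < principalMinor A s := by
  have := (hA.submatrix (Subtype.val_injective (p := (· ∈ s)))).det_pos
  rw [hA.ofReal_principalMinor] at this
  exact_mod_cast this

section Insert

variable {s : Finset ι} {i : ι}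

lemma det_submatrix_insertEnum (A : Matrix ι ι ℂ) (hi : i ∉ s) :
    (A.submatrix (insertEnum s i) (insertEnum s i)).det =
      (A.submatrix (Subtype.val : {j // j ∈ insert i s} → ι) Subtype.val).det :=
  det_submatrix_eq_of_range A (insertEnum_injective hi) fun j => by
    simp [insertEnum, or_comm, eq_comm]

lemma Matrix.PosDef.principalMinor_insert_le (hA : A.PosDef) (hi : i ∉ s) :
    principalMinor A (insert i s) ≤ (A i i).re * principalMinor A s := by
  have h := (hA.submatrix (insertEnum_injective hi)).det_div_le_corner
  change _ / (A.submatrix (Subtype.val : s → ι) Subtype.val).det ≤ A i i at h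
  rw [det_submatrix_insertEnum _ hi, hA.ofReal_principalMinor, hA.ofReal_principalMinor,
    hA.ofReal_re_diag] at h
  rw [← div_le_iff₀ (hA.principalMinor_pos s)]
  exact_mod_cast h

/-- `det (A ⊙ B) / (det A * det B)`, computed on the principal submatrices supported on `s`. -/
noncomputable def minorRatio (A B : Matrix ι ι ℂ) (s : Finset ι) : ℝ :=
  principalMinor (A ⊙ B) s / (principalMinor A s * principalMinor B s)

lemma minorRatio_pos (hA : A.PosDef) (hB : B.PosDef) (s : Finset ι) : 0 < minorRatio A B s :=
  div_pos ((hA.hadamard hB).principalMinor_pos s)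
    (mul_pos (hA.principalMinor_pos s) (hB.principalMinor_pos s))

lemma le_minorRatio_insert (hA : A.PosDef) (hB : B.PosDef) (hi : i ∉ s) :
    minorRatio A B s * ((A i i).re * principalMinor A s / principalMinor A (insert i s) +
      (B i i).re * principalMinor B s / principalMinor B (insert i s) - 1) ≤
      minorRatio A B (insert i s) := by
  have hinj := insertEnum_injective hi
  have h := (hA.submatrix hinj).le_det_hadamard (hB.submatrix hinj)
  rw [← submatrix_hadamard] at h
  change (A i i * (_ / (B.submatrix (Subtype.val : s → ι) Subtype.val).det) +
    _ / (A.submatrix (Subtype.val : s → ι) Subtype.val).det * B i i -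
    _ / (A.submatrix (Subtype.val : s → ι) Subtype.val).det *
      (_ / (B.submatrix (Subtype.val : s → ι) Subtype.val).det)) *
    ((A ⊙ B).submatrix (Subtype.val : s → ι) Subtype.val).det ≤ _ at h
  rw [det_submatrix_insertEnum _ hi, det_submatrix_insertEnum _ hi, det_submatrix_insertEnum _ hi,
    hA.ofReal_principalMinor, hA.ofReal_principalMinor, hB.ofReal_principalMinor,
    hB.ofReal_principalMinor, (hA.hadamard hB).ofReal_principalMinor,
    (hA.hadamard hB).ofReal_principalMinor, hA.ofReal_re_diag, hB.ofReal_re_diag] at h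
  norm_cast at h
  have a0 := hA.principalMinor_pos s
  have a1 := hA.principalMinor_pos (insert i s)
  have b0 := hB.principalMinor_pos s
  have b1 := hB.principalMinor_pos (insert i s)
  unfold minorRatio
  rw [le_div_iff₀ (by positivity)]
  refine le_of_eq_of_le ?_ h
  field_simp

end Insert

lemma Matrix.PosDef.principalMinor_le_prod_diag (hA : A.PosDef) (s : Finset ι) :
    principalMinor A s ≤ ∏ i ∈ s, (A i i).re := by
  induction s using Finset.induction_on with
  | empty => simp [principalMinor_empty]
  | insert i s hi ih =>
    rw [Finset.prod_insert hi]
    refine (hA.principalMinor_insert_le hi).trans (mul_le_mul_of_nonneg_left ih ?_)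
    exact (Complex.nonneg_iff.mp hA.posSemidef.diag_nonneg).1

/-- The ratio `(∏ i ∈ t, A i i) * det A[s] / det A[s ∪ t]`. -/
noncomputable def diagRatio (A : Matrix ι ι ℂ) (s t : Finset ι) : ℝ :=
  (∏ i ∈ t, (A i i).re) * principalMinor A s / principalMinor A (s ∪ t)

lemma diagRatio_empty (hA : A.PosDef) (s : Finset ι) : diagRatio A s ∅ = 1 := by
  simp [diagRatio, (hA.principalMinor_pos s).ne']

lemma diagRatio_insert (hA : A.PosDef) (s : Finset ι) {t : Finset ι} {i : ι} (hi : i ∉ t) :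
    diagRatio A s (insert i t) = diagRatio A s t *
      ((A i i).re * principalMinor A (s ∪ t) / principalMinor A (insert i (s ∪ t))) := by
  have h0 := (hA.principalMinor_pos (s ∪ t)).ne'
  rw [diagRatio, diagRatio, Finset.prod_insert hi, Finset.union_insert]
  field_simp

lemma one_le_diagRatio (hA : A.PosDef) {s t : Finset ι} (h : Disjoint s t) :
    1 ≤ diagRatio A s t := by
  induction t using Finset.induction_on with
  | empty => rw [diagRatio_empty hA]
  | insert i t hi ih =>
    rw [Finset.disjoint_insert_right] at h
    rw [diagRatio_insert hA s hi]
    refine one_le_mul_of_one_le_of_one_le (ih h.2) ?_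
    rw [one_le_div (hA.principalMinor_pos _)]
    exact hA.principalMinor_insert_le (by simp [h.1, hi])

lemma le_minorRatio_union (hA : A.PosDef) (hB : B.PosDef) {s t : Finset ι} (h : Disjoint s t) :
    minorRatio A B s * (diagRatio A s t + diagRatio B s t - 1) ≤ minorRatio A B (s ∪ t) := by
  induction t using Finset.induction_on with
  | empty => simp [diagRatio_empty hA, diagRatio_empty hB]
  | insert i t hi ih =>
    have h' := Finset.disjoint_insert_right.mp h
    have hi' : i ∉ s ∪ t := by simp [h'.1, hi]
    have hs := le_minorRatio_insert hA hB hi'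
    have ih := ih h'.2
    have hx := one_le_diagRatio hA h'.2
    have hy := one_le_diagRatio hB h'.2
    have hu : 1 ≤ (A i i).re * principalMinor A (s ∪ t) / principalMinor A (insert i (s ∪ t)) := by
      rw [one_le_div (hA.principalMinor_pos _)]
      exact hA.principalMinor_insert_le hi'
    have hv : 1 ≤ (B i i).re * principalMinor B (s ∪ t) / principalMinor B (insert i (s ∪ t)) := by
      rw [one_le_div (hB.principalMinor_pos _)]
      exact hB.principalMinor_insert_le hi'
    rw [diagRatio_insert hA s hi, diagRatio_insert hB s hi, Finset.union_insert]
    refine le_trans ?_ ((mul_le_mul_of_nonneg_right ih (by linarith)).trans hs)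
    rw [mul_assoc]
    refine mul_le_mul_of_nonneg_left ?_ (minorRatio_pos hA hB s).le
    nlinarith [mul_nonneg (sub_nonneg.2 hx) (sub_nonneg.2 hv),
      mul_nonneg (sub_nonneg.2 hy) (sub_nonneg.2 hu)]

/-- The ratio `det A[t] * det A[s] / det A[s ∪ t]`. -/
noncomputable def fischerRatio (A : Matrix ι ι ℂ) (s t : Finset ι) : ℝ :=
  principalMinor A t * principalMinor A s / principalMinor A (s ∪ t)

lemma fischerRatio_pos (hA : A.PosDef) (s t : Finset ι) : 0 < fischerRatio A s t :=
  div_pos (mul_pos (hA.principalMinor_pos t) (hA.principalMinor_pos s)) (hA.principalMinor_pos _)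

lemma fischerRatio_le_diagRatio (hA : A.PosDef) (s t : Finset ι) :
    fischerRatio A s t ≤ diagRatio A s t :=
  div_le_div_of_nonneg_right (mul_le_mul_of_nonneg_right (hA.principalMinor_le_prod_diag t)
    (hA.principalMinor_pos s).le) (hA.principalMinor_pos _).le

lemma abs_fischerRatio_le (hA : A.PosDef) (hB : B.PosDef) {s t : Finset ι} (h : Disjoint s t) :
    |fischerRatio A s t + fischerRatio B s t - 1| ≤ diagRatio A s t + diagRatio B s t - 1 := by
  have := fischerRatio_pos hA s t
  have := fischerRatio_pos hB s t
  have := fischerRatio_le_diagRatio hA s t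
  have := fischerRatio_le_diagRatio hB s t
  have := one_le_diagRatio hA h
  have := one_le_diagRatio hB h
  rw [abs_le]
  constructor <;> linarith

lemma one_le_minorRatio (hA : A.PosDef) (hB : B.PosDef) (s : Finset ι) :
    1 ≤ minorRatio A B s := by
  have h := le_minorRatio_union hA hB (Finset.disjoint_empty_left s)
  have h1 : minorRatio A B ∅ = 1 := by simp [minorRatio, principalMinor_empty]
  rw [h1, one_mul, Finset.empty_union] at h
  linarith [one_le_diagRatio hA (Finset.disjoint_empty_left s),
    one_le_diagRatio hB (Finset.disjoint_empty_left s)]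

end PrincipalMinor

section Block

variable {n k : ℕ}

/-- The indices lying in the first `μ` blocks. -/
def leadIndices (n k μ : ℕ) : Finset (Fin n × Fin k) := {p | p.1.1 < μ}

/-- The indices lying in the `μ`-th (1-based) block. -/
def blockIndices (n k μ : ℕ) : Finset (Fin n × Fin k) := {p | p.1.1 = μ - 1}

lemma re_det_leadBlock (A : Matrix (Fin n × Fin k) (Fin n × Fin k) ℂ) (μ : ℕ) (h : μ ≤ n) :
    (leadBlock A μ h).det.re = principalMinor A (leadIndices n k μ) := by
  rw [leadBlock, principalMinor]
  refine congrArg _ (det_submatrix_eq_of_range A (fun p q hpq => ?_) fun ⟨i, a⟩ => ?_)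
  · simpa [Prod.ext_iff, Fin.ext_iff] using hpq
  · simp only [leadIndices, Finset.mem_filter_univ]
    exact ⟨fun hi => ⟨(⟨i, hi⟩, a), rfl⟩, fun ⟨p, hp⟩ => by
      obtain rfl := congrArg Prod.fst hp
      exact p.1.2⟩

lemma re_det_diagBlock (A : Matrix (Fin n × Fin k) (Fin n × Fin k) ℂ) (μ : ℕ) (h : μ - 1 < n) :
    (diagBlock A μ h).det.re = principalMinor A (blockIndices n k μ) := by
  rw [principalMinor, ← det_submatrix_eq_of_range A (f := fun a => (⟨μ - 1, h⟩, a))]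
  · rfl
  · intro a b hab
    simpa using hab
  · rintro ⟨i, a⟩
    simp [blockIndices, Fin.ext_iff, eq_comm]

lemma leadIndices_succ_union (μ : ℕ) :
    leadIndices n k μ ∪ blockIndices n k (μ + 1) = leadIndices n k (μ + 1) := by
  ext p
  simp [leadIndices, blockIndices]
  omega

lemma disjoint_leadIndices_blockIndices (μ : ℕ) :
    Disjoint (leadIndices n k μ) (blockIndices n k (μ + 1)) := by
  rw [Finset.disjoint_left]
  intro p
  simp [leadIndices, blockIndices]
  omega

lemma prod_le_minorRatio_leadIndices {A B : Matrix (Fin n × Fin k) (Fin n × Fin k) ℂ}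
    (hA : A.PosDef) (hB : B.PosDef) (m : ℕ) :
    ∏ μ ∈ Finset.Icc 2 m, |fischerRatio A (leadIndices n k (μ - 1)) (blockIndices n k μ) +
        fischerRatio B (leadIndices n k (μ - 1)) (blockIndices n k μ) - 1| ≤
      minorRatio A B (leadIndices n k m) := by
  induction m with
  | zero => simpa using one_le_minorRatio hA hB _
  | succ m ih =>
    rcases Nat.eq_zero_or_pos m with rfl | hm
    · simpa using one_le_minorRatio hA hB _
    · have hd := disjoint_leadIndices_blockIndices (n := n) (k := k) m
      have h := le_minorRatio_union hA hB hd
      rw [leadIndices_succ_union] at h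
      rw [Finset.prod_Icc_succ_top (by omega), Nat.add_sub_cancel]
      exact (mul_le_mul ih (abs_fischerRatio_le hA hB hd) (abs_nonneg _)
        (minorRatio_pos hA hB _).le).trans h

end Block

/-- **Theorem 2.6.** For positive definite block matrices `A, B ∈ M_n(M_k)`,
`det(A ∘ B) ≥ det(AB) · ∏_{μ=2}^n (det A_{μμ} det A_{μ-1}/det A_μ +
det B_{μμ} det B_{μ-1}/det B_μ − 1)`. -/
theorem oppenheim_block_two {n k : ℕ}
    (A B : Matrix (Fin n × Fin k) (Fin n × Fin k) ℂ)
    (hA : A.PosDef) (hB : B.PosDef) :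
    (Matrix.hadamard A B).det.re ≥
      (A * B).det.re *
        ∏ μ ∈ (Finset.Icc 2 n).attach,
          ((diagBlock A μ.1 (by have := Finset.mem_Icc.mp μ.2; omega)).det.re *
              (leadBlock A (μ.1 - 1) (by have := Finset.mem_Icc.mp μ.2; omega)).det.re /
              (leadBlock A μ.1 (by have := Finset.mem_Icc.mp μ.2; omega)).det.re +
            (diagBlock B μ.1 (by have := Finset.mem_Icc.mp μ.2; omega)).det.re *
              (leadBlock B (μ.1 - 1) (by have := Finset.mem_Icc.mp μ.2; omega)).det.re /
              (leadBlock B μ.1 (by have := Finset.mem_Icc.mp μ.2; omega)).det.re - 1) := by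
  have hlead : leadIndices n k n = Finset.univ := by
    ext p
    simp [leadIndices]
  have h := prod_le_minorRatio_leadIndices hA hB n
  rw [← Finset.abs_prod, hlead] at h
  replace h := (le_abs_self _).trans h
  have hdet : (A * B).det.re = A.det.re * B.det.re := by
    rw [det_mul, Complex.mul_re, (Complex.pos_iff.mp hA.det_pos).2.symm]
    simp
  have hpos := mul_pos (hA.principalMinor_pos Finset.univ) (hB.principalMinor_pos Finset.univ)
  rw [minorRatio, le_div_iff₀' hpos, principalMinor_univ, principalMinor_univ,
    principalMinor_univ, ← hdet] at h
  refine ge_iff_le.mpr (le_of_eq_of_le (congrArg _ ?_) h)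
  rw [← Finset.prod_attach (Finset.Icc 2 n)]
  refine Finset.prod_congr rfl fun μ _ => ?_
  have hμ := Finset.mem_Icc.mp μ.2
  have hunion := leadIndices_succ_union (n := n) (k := k) (μ.1 - 1)
  rw [Nat.sub_add_cancel (by omega)] at hunion
  simp only [re_det_leadBlock, re_det_diagBlock, fischerRatio, hunion]
end

section
/- Let A = [A_{ij}] and B = [B_{ij}] be positive definite complex matrices of size nk × nk, each regarded as an n × n block matrix with k × k blocks, and let 2 ≤ μ ≤ n. Then det(A_μ ∘ B_μ)/det(A_{μ−1} ∘ B_{μ−1}) + det(A_μ B_μ)/det(A_{μ−1} B_{μ−1}) ≥ det A_{μμ} · det B_μ / det B_{μ−1} + det B_{μμ} · det A_μ / det A_{μ−1}, where all quantities are positive reals and the inequality is of real numbers. -/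
open Matrix ComplexOrder

namespace Matrix

variable {ι p q : Type*} [Fintype p] [DecidableEq p] [Fintype q] [DecidableEq q]

/-- The real part of the minor of `A` with rows and columns selected by `f`. -/
noncomputable def principalMinor (A : Matrix ι ι ℂ) (f : p → ι) : ℝ :=
  (A.submatrix f f).det.re

lemma principalMinor_comp_equiv (A : Matrix ι ι ℂ) (f : p → ι) (e : q ≃ p) :
    principalMinor A (f ∘ e) = principalMinor A f := by
  unfold principalMinor
  rw [← det_submatrix_equiv_self e (A.submatrix f f), submatrix_submatrix]

lemma PosDef.principalMinor_pos_s10 {A : Matrix ι ι ℂ} (hA : A.PosDef) {f : p → ι}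
    (hf : f.Injective) : 0 < principalMinor A f :=
  (Complex.pos_iff.mp (hA.submatrix hf).det_pos).1

/-- The factor by which the principal minor of `A` selected by `f` grows when the index `i` is
appended. -/
noncomputable def minorRatio (A : Matrix ι ι ℂ) (f : p → ι) (i : ι) : ℝ :=
  principalMinor A (Sum.elim f fun _ : Fin 1 => i) / principalMinor A f

/-- The diagonal matrix whose last entry is `c` and whose other entries vanish. -/
noncomputable def lastCorner (p : Type*) [DecidableEq p] (c : ℝ) :
    Matrix (p ⊕ Fin 1) (p ⊕ Fin 1) ℂ :=
  diagonal (Sum.elim (fun _ => 0) fun _ => (c : ℂ))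

lemma PosDef.det_im_eq_zero {A : Matrix p p ℂ} (hA : A.PosDef) : A.det.im = 0 :=
  (Complex.pos_iff.mp hA.det_pos).2.symm

/-- The Schur complement of the leading part is the largest multiple of the last diagonal unit
that can be subtracted from a positive definite matrix while keeping it positive semidefinite. -/
lemma PosDef.posSemidef_sub_lastCorner_iff {A : Matrix ι ι ℂ} (hA : A.PosDef) {f : p → ι} {i : ι}
    (hf : (Sum.elim f fun _ : Fin 1 => i).Injective) (c : ℝ) :
    (A.submatrix (Sum.elim f fun _ : Fin 1 => i) (Sum.elim f fun _ : Fin 1 => i) -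
      lastCorner p c).PosSemidef ↔ c ≤ minorRatio A f i := by
  have hfi : f.Injective := hf.comp Sum.inl_injective
  have hP := hA.submatrix hfi
  have hM := hA.submatrix hf
  set P := A.submatrix f f
  set X : Matrix p (Fin 1) ℂ := A.submatrix f (fun _ => i) with hX
  set D : Matrix (Fin 1) (Fin 1) ℂ := A.submatrix (fun _ => i) (fun _ => i)
  have hXH : Xᴴ = A.submatrix (fun _ => i) f := by
    rw [hX, conjTranspose_submatrix, hA.isHermitian.eq]
  have hblocks : A.submatrix (Sum.elim f fun _ : Fin 1 => i) (Sum.elim f fun _ : Fin 1 => i) =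
      fromBlocks P X Xᴴ D := by
    rw [hXH]
    ext (a | a) (b | b) <;> rfl
  have hsub : fromBlocks P X Xᴴ D - lastCorner p c =
      fromBlocks P X Xᴴ (D - diagonal fun _ => (c : ℂ)) := by
    ext (a | a) (b | b) <;> simp [lastCorner, diagonal_apply]
  have : Invertible P := hP.isUnit.invertible
  have hdet : (fromBlocks P X Xᴴ D).det = P.det * (D - Xᴴ * P⁻¹ * X) 0 0 := by
    rw [det_fromBlocks₁₁, invOf_eq_nonsing_inv, det_fin_one]
  have hPpos : 0 < P.det.re := hA.principalMinor_pos_s10 hfi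
  have hPim := hP.det_im_eq_zero
  rw [hblocks] at hM
  have hMim := hM.det_im_eq_zero
  rw [hdet, Complex.mul_im, hPim, zero_mul, add_zero] at hMim
  have him : ((D - Xᴴ * P⁻¹ * X) 0 0).im = 0 := by
    rcases mul_eq_zero.mp hMim with h | h
    · exact absurd h hPpos.ne'
    · exact h
  have hratio : minorRatio A f i = ((D - Xᴴ * P⁻¹ * X) 0 0).re := by
    unfold minorRatio principalMinor
    rw [hblocks, hdet, Complex.mul_re, hPim, zero_mul, sub_zero, mul_div_cancel_left₀ _ hPpos.ne']
  rw [hblocks, hsub, PosDef.fromBlocks₁₁ _ _ hP, hratio]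
  have hdiag : D - (diagonal fun _ => (c : ℂ)) - Xᴴ * P⁻¹ * X =
      diagonal fun _ => (D - Xᴴ * P⁻¹ * X) 0 0 - (c : ℂ) := by
    ext a b
    fin_cases a; fin_cases b
    exact sub_right_comm _ _ _
  rw [hdiag, posSemidef_diagonal_iff]
  rw [sub_apply, Complex.sub_im] at him
  simp [Complex.le_def, him]

lemma PosDef.posSemidef_sub_minorRatio {A : Matrix ι ι ℂ} (hA : A.PosDef) {f : p → ι} {i : ι}
    (hf : (Sum.elim f fun _ : Fin 1 => i).Injective) :
    (A.submatrix (Sum.elim f fun _ : Fin 1 => i) (Sum.elim f fun _ : Fin 1 => i) -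
      lastCorner p (minorRatio A f i)).PosSemidef :=
  (hA.posSemidef_sub_lastCorner_iff hf _).mpr le_rfl

lemma PosDef.minorRatio_pos {A : Matrix ι ι ℂ} (hA : A.PosDef) {f : p → ι} {i : ι}
    (hf : (Sum.elim f fun _ : Fin 1 => i).Injective) : 0 < minorRatio A f i :=
  div_pos (hA.principalMinor_pos_s10 hf) (hA.principalMinor_pos_s10 (hf.comp Sum.inl_injective))

lemma PosDef.minorRatio_le_diag {A : Matrix ι ι ℂ} (hA : A.PosDef) {f : p → ι} {i : ι}
    (hf : (Sum.elim f fun _ : Fin 1 => i).Injective) : minorRatio A f i ≤ (A i i).re := by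
  have h := (hA.posSemidef_sub_minorRatio hf).diag_nonneg (i := Sum.inr 0)
  simpa [lastCorner] using (Complex.le_def.mp h).1

/-- Enlarging the set of previously eliminated indices decreases the ratio of minors. -/
lemma PosDef.minorRatio_le_of_comp {A : Matrix ι ι ℂ} (hA : A.PosDef) {f : p → ι} {i : ι}
    (hf : (Sum.elim f fun _ : Fin 1 => i).Injective) {g : q → p} (hg : g.Injective) :
    minorRatio A f i ≤ minorRatio A (f ∘ g) i := by
  have hmap : (Sum.map g (id : Fin 1 → Fin 1)).Injective :=
    Sum.map_injective.mpr ⟨hg, Function.injective_id⟩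
  have hcomp : (Sum.elim (f ∘ g) fun _ : Fin 1 => i) =
      (Sum.elim f fun _ : Fin 1 => i) ∘ Sum.map g id := by
    ext (a | a) <;> rfl
  rw [← hA.posSemidef_sub_lastCorner_iff (hcomp ▸ hf.comp hmap)]
  convert! (hA.posSemidef_sub_minorRatio hf).submatrix (Sum.map g id) using 1
  ext (a | a) (b | b) <;> simp [lastCorner, diagonal_apply]

/-- The scalar Oppenheim–Schur inequality for consecutive ratios of minors. -/
lemma PosDef.minorRatio_hadamard_ge {A B : Matrix ι ι ℂ} (hA : A.PosDef) (hB : B.PosDef)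
    {f : p → ι} {i : ι} (hf : (Sum.elim f fun _ : Fin 1 => i).Injective) :
    minorRatio A f i * (B i i).re + minorRatio B f i * (A i i).re -
      minorRatio A f i * minorRatio B f i ≤ minorRatio (A ⊙ B) f i := by
  rw [← (hA.hadamard hB).posSemidef_sub_lastCorner_iff hf]
  have hre : ∀ {M : Matrix ι ι ℂ}, M.PosDef → M i i = ((M i i).re : ℂ) := fun hM =>
    Complex.ext rfl (by simpa using (Complex.pos_iff.mp hM.diag_pos).2.symm)
  have hAi := hre hA
  have hBi := hre hB
  convert! (hA.posSemidef_sub_minorRatio hf).hadamard (hB.posSemidef_sub_minorRatio hf) using 1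
  ext (a | a) (b | b)
  · simp [lastCorner, diagonal_apply]
  · simp [lastCorner]
  · simp [lastCorner]
  · rw [Subsingleton.elim a b]
    simp only [sub_apply, submatrix_apply, hadamard_apply, Sum.elim_inr, lastCorner,
      diagonal_apply_eq]
    rw [hAi, hBi]
    push_cast
    simp only [Complex.ofReal_re]
    ring

/-- A ratio of minors with one more index factors through `minorRatio`. -/
lemma PosDef.principalMinor_snoc {A : Matrix ι ι ℂ} (hA : A.PosDef) {k : ℕ} {f : p → ι}
    {g : Fin (k + 1) → ι} (hf : (Sum.elim f (g ∘ Fin.castSucc)).Injective) :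
    principalMinor A (Sum.elim f g) =
      minorRatio A (Sum.elim f (g ∘ Fin.castSucc)) (g (Fin.last k)) *
        principalMinor A (Sum.elim f (g ∘ Fin.castSucc)) := by
  rw [minorRatio, div_mul_cancel₀ _ (hA.principalMinor_pos_s10 hf).ne',
    ← principalMinor_comp_equiv A (Sum.elim f g)
      ((Equiv.sumAssoc p (Fin k) (Fin 1)).trans
        (Equiv.sumCongr (Equiv.refl p) finSumFinEquiv))]
  congr 1
  ext ((a | a) | a)
  · rfl
  · rfl
  · rw [Subsingleton.elim a 0]
    rfl

omit [Fintype p] [DecidableEq p] in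
lemma injective_sumElim_snoc {k : ℕ} {f : p → ι} {g : Fin (k + 1) → ι}
    (hfg : (Sum.elim f g).Injective) :
    (Sum.elim (Sum.elim f (g ∘ Fin.castSucc)) fun _ : Fin 1 => g (Fin.last k)).Injective := by
  rw [Sum.elim_injective] at hfg ⊢
  obtain ⟨hf, hg, h⟩ := hfg
  refine ⟨Sum.elim_injective.mpr ⟨hf, hg.comp (Fin.castSucc_injective k), fun a b => h a _⟩,
    Function.injective_of_subsingleton _, ?_⟩
  rintro (a | a) b
  · exact h a _
  · exact fun hab => (Fin.castSucc_lt_last a).ne (hg hab)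

/-- Scalar Oppenheim–Schur inequalities are stable under multiplication. -/
lemma mul_oppenheim {a b d e x y m a' b' d' e' m' : ℝ} (ha : 0 < a) (hb : 0 < b)
    (had : a ≤ d) (hbe : b ≤ e) (hdx : d ≤ x) (hey : e ≤ y) (hm : a * y + b * x - a * b ≤ m)
    (ha' : 0 < a') (hb' : 0 < b') (had' : a' ≤ d') (hbe' : b' ≤ e')
    (hm' : d' * b' + e' * a' ≤ m' + a' * b') :
    a * a' ≤ d * d' ∧ b * b' ≤ e * e' ∧
      d * d' * (b * b') + e * e' * (a * a') ≤ m * m' + a * a' * (b * b') := by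
  have hd : 0 < d := ha.trans_le had
  have he : 0 < e := hb.trans_le hbe
  refine ⟨mul_le_mul had had' ha'.le hd.le, mul_le_mul hbe hbe' hb'.le he.le, ?_⟩
  have h₁ : a * e + b * d - a * b ≤ m := by
    nlinarith [mul_le_mul_of_nonneg_left hey ha.le, mul_le_mul_of_nonneg_left hdx hb.le]
  have h₂ : d' * b' + e' * a' - a' * b' ≤ m' := by linarith
  have hp : 0 ≤ (d - a) * b := mul_nonneg (sub_nonneg.mpr had) hb.le
  have hq : 0 ≤ (e - b) * a := mul_nonneg (sub_nonneg.mpr hbe) ha.le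
  have hp' : 0 ≤ (d' - a') * b' := mul_nonneg (sub_nonneg.mpr had') hb'.le
  have hq' : 0 ≤ (e' - b') * a' := mul_nonneg (sub_nonneg.mpr hbe') ha'.le
  have hab : 0 < a * b := mul_pos ha hb
  have hab' : 0 < a' * b' := mul_pos ha' hb'
  have hmul : (a * e + b * d - a * b) * (d' * b' + e' * a' - a' * b') ≤ m * m' :=
    mul_le_mul h₁ h₂ (by linarith) (by linarith)
  nlinarith [mul_nonneg hp hq', mul_nonneg hq hp']

/-- The Oppenheim–Schur inequality for minors relative to a fixed leading index set, together with
Fischer's inequality for each factor. -/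
lemma PosDef.principalMinor_hadamard_ge {A B : Matrix ι ι ℂ} (hA : A.PosDef) (hB : B.PosDef)
    (f : p → ι) {k : ℕ} (g : Fin k → ι) (hfg : (Sum.elim f g).Injective) :
    principalMinor A (Sum.elim f g) / principalMinor A f ≤ principalMinor A g ∧
    principalMinor B (Sum.elim f g) / principalMinor B f ≤ principalMinor B g ∧
    principalMinor A g * (principalMinor B (Sum.elim f g) / principalMinor B f) +
        principalMinor B g * (principalMinor A (Sum.elim f g) / principalMinor A f) ≤
      principalMinor (A ⊙ B) (Sum.elim f g) / principalMinor (A ⊙ B) f +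
        principalMinor A (Sum.elim f g) / principalMinor A f *
          (principalMinor B (Sum.elim f g) / principalMinor B f) := by
  induction k with
  | zero =>
    have hf : f.Injective := hfg.comp Sum.inl_injective
    have hone : ∀ {M : Matrix ι ι ℂ}, M.PosDef →
        principalMinor M (Sum.elim f g) / principalMinor M f = 1 ∧ principalMinor M g = 1 := by
      intro M hM
      constructor
      · rw [div_eq_one_iff_eq (hM.principalMinor_pos_s10 hf).ne',
          ← principalMinor_comp_equiv M _ (Equiv.sumEmpty p (Fin 0)).symm]
        rfl
      · simp [principalMinor]
    obtain ⟨h₁, h₂⟩ := hone hA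
    obtain ⟨h₃, h₄⟩ := hone hB
    rw [h₁, h₂, h₃, h₄, (hone (hA.hadamard hB)).1]
    norm_num
  | succ k ih =>
    have hlast := injective_sumElim_snoc hfg
    set g₀ := g ∘ Fin.castSucc
    set i := g (Fin.last k)
    have hinit : (Sum.elim f g₀).Injective := hlast.comp Sum.inl_injective
    have hf : f.Injective := hinit.comp Sum.inl_injective
    have hg : g₀.Injective := hinit.comp Sum.inr_injective
    have hglast : (Sum.elim g₀ fun _ : Fin 1 => i).Injective := by
      have := hlast.comp (Sum.map_injective.mpr
        ⟨Sum.inr_injective (α := p) (β := Fin k), Function.injective_id (α := Fin 1)⟩)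
      convert! this using 1
      ext (a | a) <;> rfl
    have hAB := hA.hadamard hB
    obtain ⟨ihA, ihB, ihAB⟩ := ih g₀ hinit
    have key : ∀ {M : Matrix ι ι ℂ}, M.PosDef → principalMinor M g =
        minorRatio M g₀ i * principalMinor M g₀ := by
      intro M hM
      rw [minorRatio, div_mul_cancel₀ _ (hM.principalMinor_pos_s10 hg).ne',
        ← principalMinor_comp_equiv M g finSumFinEquiv]
      congr 1
      ext (a | a)
      · rfl
      · rw [Subsingleton.elim a 0]
        rfl
    rw [hA.principalMinor_snoc hinit, hB.principalMinor_snoc hinit, hAB.principalMinor_snoc hinit,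
      key hA, key hB]
    simp only [mul_div_assoc]
    exact mul_oppenheim (hA.minorRatio_pos hlast) (hB.minorRatio_pos hlast)
      (hA.minorRatio_le_of_comp hlast Sum.inr_injective)
      (hB.minorRatio_le_of_comp hlast Sum.inr_injective)
      (hA.minorRatio_le_diag hglast) (hB.minorRatio_le_diag hglast)
      (hA.minorRatio_hadamard_ge hB hlast)
      (div_pos (hA.principalMinor_pos_s10 hinit) (hA.principalMinor_pos_s10 hf))
      (div_pos (hB.principalMinor_pos_s10 hinit) (hB.principalMinor_pos_s10 hf)) ihA ihB ihAB

end Matrix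

/-- **Lemma 2.5.** For positive definite block matrices `A, B ∈ M_n(M_k)` and
`2 ≤ μ ≤ n`,
`det(A_μ∘B_μ)/det(A_{μ-1}∘B_{μ-1}) + det(A_μB_μ)/det(A_{μ-1}B_{μ-1}) ≥
 det A_{μμ} · det B_μ/det B_{μ-1} + det B_{μμ} · det A_μ/det A_{μ-1}`. -/
theorem lemma25_block {n k : ℕ}
    (A B : Matrix (Fin n × Fin k) (Fin n × Fin k) ℂ)
    (hA : A.PosDef) (hB : B.PosDef)
    (μ : ℕ) (hμ2 : 2 ≤ μ) (hμn : μ ≤ n) :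
    (Matrix.hadamard (leadBlock A μ hμn) (leadBlock B μ hμn)).det.re /
        (Matrix.hadamard (leadBlock A (μ - 1) (by omega)) (leadBlock B (μ - 1) (by omega))).det.re +
      (leadBlock A μ hμn * leadBlock B μ hμn).det.re /
        (leadBlock A (μ - 1) (by omega) * leadBlock B (μ - 1) (by omega)).det.re ≥
    (diagBlock A μ (by omega)).det.re *
        (leadBlock B μ hμn).det.re / (leadBlock B (μ - 1) (by omega)).det.re +
      (diagBlock B μ (by omega)).det.re *
        (leadBlock A μ hμn).det.re / (leadBlock A (μ - 1) (by omega)).det.re := by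
  have hinj : ∀ {m : ℕ} (h : m ≤ n),
      (fun r : Fin m × Fin k => ((Fin.castLE h r.1, r.2) : Fin n × Fin k)).Injective := by
    rintro m h ⟨a, b⟩ ⟨c, d⟩ hab
    simpa using hab
  have hν : μ - 1 ≤ n := by omega
  set F : Fin μ × Fin k → Fin n × Fin k := fun r => (Fin.castLE hμn r.1, r.2)
  set f : Fin (μ - 1) × Fin k → Fin n × Fin k := fun r => (Fin.castLE hν r.1, r.2) with hf
  let g : Fin k → Fin n × Fin k := fun b => (⟨μ - 1, by omega⟩, b)
  have hfg : (Sum.elim f g).Injective := by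
    refine Sum.elim_injective.mpr ⟨hinj hν, fun a b hab => (Prod.ext_iff.mp hab).2, ?_⟩
    intro a b hab
    have h₁ := congrArg (fun r : Fin n × Fin k => (r.1 : ℕ)) hab
    have h₂ := a.1.isLt
    simp only [hf, g, Fin.val_castLE] at h₁
    omega
  have hminor : ∀ M : Matrix (Fin n × Fin k) (Fin n × Fin k) ℂ,
      principalMinor M F = principalMinor M (Sum.elim f g) := by
    intro M
    let φ : (Fin (μ - 1) × Fin k) ⊕ Fin k → Fin μ × Fin k :=
      Sum.elim (fun r => (Fin.castLE (by omega) r.1, r.2)) fun b => (⟨μ - 1, by omega⟩, b)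
    have hφ : F ∘ φ = Sum.elim f g := by
      ext (a | a) <;> rfl
    have hbij : φ.Bijective := by
      refine (Fintype.bijective_iff_injective_and_card φ).mpr ⟨.of_comp (f := F) (hφ ▸ hfg), ?_⟩
      simp only [Fintype.card_sum, Fintype.card_prod, Fintype.card_fin]
      rw [← Nat.succ_mul, Nat.succ_eq_add_one, Nat.sub_add_cancel (by omega)]
    rw [← hφ]
    exact (principalMinor_comp_equiv M F (Equiv.ofBijective φ hbij)).symm
  have hdet : ∀ {m : ℕ} (h : m ≤ n), (leadBlock A m h * leadBlock B m h).det.re =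
      (leadBlock A m h).det.re * (leadBlock B m h).det.re := by
    intro m h
    have him : (leadBlock A m h).det.im = 0 := (hA.submatrix (hinj h)).det_im_eq_zero
    rw [det_mul, Complex.mul_re, him, zero_mul, sub_zero]
  have main := (hA.principalMinor_hadamard_ge hB f g hfg).2.2
  simp only [← hminor] at main
  rw [hdet, hdet, mul_div_mul_comm, mul_div_assoc, mul_div_assoc]
  exact main
end
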